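/- There is no bicrucial permutation of length 38. -/

import Mathlib

/-- The permutation `σ` of length `n` has a square starting at position `k`
with half-length `ℓ`: the factors `(σ k, …, σ (k+ℓ-1))` and
`(σ (k+ℓ), …, σ (k+2ℓ-1))` are order-isomorphic. -/
def HasSquareAt {n : ℕ} (σ : Fin n → Fin n) (k ℓ : ℕ) : Prop :=
  2 ≤ ℓ ∧ ∃ hb : k + 2 * ℓ ≤ n, ∀ (i j : ℕ) (hi : i < ℓ) (hj : j < ℓ),
    (σ ⟨k + i, by omega⟩ < σ ⟨k + j, by omega⟩ ↔
      σ ⟨k + ℓ + i, by omega⟩ < σ ⟨k + ℓ + j, by omega⟩)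

/-- `σ` contains a square. -/
def ContainsSquare {n : ℕ} (σ : Fin n → Fin n) : Prop :=
  ∃ k ℓ : ℕ, HasSquareAt σ k ℓ

/-- `σ` is square-free: it contains no square. -/
def SquareFree {n : ℕ} (σ : Fin n → Fin n) : Prop :=
  ¬ ContainsSquare σ

/-- `π` (of length `n+1`) is a right-extension of `σ` (of length `n`):
the prefix `(π 0, …, π (n-1))` is order-isomorphic to `σ`. -/
def IsRightExtension {n : ℕ} (σ : Fin n → Fin n) (π : Fin (n + 1) → Fin (n + 1)) : Prop :=
  ∀ i j : Fin n, π i.castSucc < π j.castSucc ↔ σ i < σ j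

/-- `π` (of length `n+1`) is a left-extension of `σ` (of length `n`):
the suffix `(π 1, …, π n)` is order-isomorphic to `σ`. -/
def IsLeftExtension {n : ℕ} (σ : Fin n → Fin n) (π : Fin (n + 1) → Fin (n + 1)) : Prop :=
  ∀ i j : Fin n, π i.succ < π j.succ ↔ σ i < σ j

/-- `σ` is right-crucial: square-free, and every right-extension contains a square. -/
def RightCrucial {n : ℕ} (σ : Equiv.Perm (Fin n)) : Prop :=
  SquareFree ⇑σ ∧ ∀ π : Equiv.Perm (Fin (n + 1)), IsRightExtension ⇑σ ⇑π → ContainsSquare ⇑π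

/-- `σ` is left-crucial: square-free, and every left-extension contains a square. -/
def LeftCrucial {n : ℕ} (σ : Equiv.Perm (Fin n)) : Prop :=
  SquareFree ⇑σ ∧ ∀ π : Equiv.Perm (Fin (n + 1)), IsLeftExtension ⇑σ ⇑π → ContainsSquare ⇑π

/-- `σ` is bicrucial: both left-crucial and right-crucial. -/
def Bicrucial {n : ℕ} (σ : Equiv.Perm (Fin n)) : Prop :=
  LeftCrucial σ ∧ RightCrucial σ

namespace NB38

/-! ### Conditions on the value sequence `f 0, …, f 37` of a bicrucial permutation -/

/-- The possible half-lengths of squares: 2, 4, 8, 12, 16. -/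
def dOf (q : ℕ) : ℕ := if q = 0 then 2 else 4 * q

/-- The pair `(i, j)` compares in the same way as its translate by `d`. -/
def Same (f : ℕ → ℕ) (d i j : ℕ) : Prop := f i < f j ↔ f (i + d) < f (j + d)

/-- Start of the first block of a near-square (side 0 = right end, side 1 = left end). -/
def lo (s q : ℕ) : ℕ := if s = 0 then 39 - 2 * dOf q else 0

/-- Start of the block in which the new element is placed. -/
def lo2 (s q : ℕ) : ℕ := if s = 0 then 39 - dOf q else 0

/-- The element corresponding to the new one in the other half. -/
def piv (s q : ℕ) : ℕ := if s = 0 then 38 - dOf q else dOf q - 1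

/-- The element corresponding to `i` in the other half. -/
def par (s q i : ℕ) : ℕ := if s = 0 then i - dOf q else i + dOf q

/-- There is a near-square of half-length `dOf q` at the end `s`. -/
def NS (f : ℕ → ℕ) (s q : ℕ) : Prop :=
  ∀ i j, lo s q ≤ i → i < j → j < lo s q + (dOf q - 1) → Same f (dOf q) i j

/-- The new element just below (`dr = 0`) or above (`dr = 1`) `f e` completes a square. -/
def CV (f : ℕ → ℕ) (s dr e q : ℕ) : Prop :=
  NS f s q ∧ ∀ i, lo2 s q ≤ i → i < lo2 s q + (dOf q - 1) →
    (f e + dr ≤ f i ↔ f (piv s q) < f (par s q i))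

structure Hyp (f : ℕ → ℕ) : Prop where
  inj : ∀ i j, i < 38 → j < 38 → f i = f j → i = j
  nosq : ∀ q k, q < 5 → k + 2 * dOf q ≤ 38 →
    ∃ i j, k ≤ i ∧ i < j ∧ j < k + dOf q ∧ ¬ Same f (dOf q) i j
  cover : ∀ s dr e, s < 2 → dr < 2 → e < 38 → ∃ q < 5, CV f s dr e q

/-! ### A checker for refutations -/

/-- Meaning of the atoms. -/
def V (f : ℕ → ℕ) (t i j : ℕ) : Prop :=
  if t = 0 then f i < f j
  else if t < 6 then Same f (dOf (t - 1)) i j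
  else if t = 6 then NS f i j
  else CV f ((t - 7) / 2) ((t - 7) % 2) i j

/-- Meaning of the literals. -/
def ev (f : ℕ → ℕ) (l : ℕ) : Prop :=
  if l % 2 = 0 then V f (l / 8192) (l / 128 % 64) (l / 2 % 64)
  else ¬ V f (l / 8192) (l / 128 % 64) (l / 2 % 64)

def pos (t i j : ℕ) : ℕ := 2 * ((t * 64 + i) * 64 + j)
def neg (t i j : ℕ) : ℕ := 2 * ((t * 64 + i) * 64 + j) + 1
def flip (l : ℕ) : ℕ := if l % 2 = 0 then l + 1 else l - 1

/-- The literal `f i < f j`. -/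
def lt (i j : ℕ) : ℕ := if i < j then pos 0 i j else neg 0 j i

/-- All literals `¬ Same f (dOf q) i j` with `k ≤ i < j < k + d`. -/
def sqClause (k d t : ℕ) : List ℕ :=
  (List.range d).flatMap fun j => (List.range j).map fun i => neg t (k + i) (k + j)

/-- A clause which is always true. -/
def taut : List ℕ := [0, 1]

def clauseB (v a b c : ℕ) (first : Bool) : List ℕ :=
  let s := v / 2
  let dr := v % 2
  let p := piv s b
  let r := par s b c
  if a < 38 ∧ b < 5 ∧ lo2 s b ≤ c ∧ c < lo2 s b + (dOf b - 1) then
    if c = a then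
      if first then (if dr = 0 then [neg (7 + v) a b, lt p r] else taut)
      else (if dr = 0 then taut else [neg (7 + v) a b, lt r p])
    else if first then [neg (7 + v) a b, lt c a, lt p r]
    else [neg (7 + v) a b, lt a c, lt r p]
  else taut

/-- The clause with a given code. -/
def clauseA (tag a b c : ℕ) : List ℕ :=
  if tag = 1 then
    if a < 38 ∧ b < 38 ∧ c < 38 ∧ a ≠ b ∧ b ≠ c ∧ a ≠ c then [lt b a, lt c b, lt a c] else taut
  else if tag < 6 then
    if a < b ∧ b + dOf c < 38 ∧ c < 5 then
      let d := dOf c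
      if tag = 2 then [neg (1 + c) a b, neg 0 a b, pos 0 (a + d) (b + d)]
      else if tag = 3 then [neg (1 + c) a b, pos 0 a b, neg 0 (a + d) (b + d)]
      else if tag = 4 then [pos (1 + c) a b, pos 0 a b, pos 0 (a + d) (b + d)]
      else [pos (1 + c) a b, neg 0 a b, neg 0 (a + d) (b + d)]
    else taut
  else if tag = 6 then
    if b < 5 ∧ a + 2 * dOf b ≤ 38 then sqClause a (dOf b) (1 + b) else taut
  else if tag < 9 then
    let s := tag - 7
    if lo s c ≤ a ∧ a < b ∧ b < lo s c + (dOf c - 1) ∧ b < 38 ∧ c < 5 then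
      [neg 6 s c, pos (1 + c) a b]
    else taut
  else if tag < 13 then
    if a < 38 ∧ b < 5 then [neg (7 + (tag - 9)) a b, pos 6 ((tag - 9) / 2) b] else taut
  else if tag < 17 then clauseB (tag - 13) a b c true
  else if tag < 21 then clauseB (tag - 17) a b c false
  else if tag < 25 then
    if a < 38 then
      [pos (tag - 14) a 0, pos (tag - 14) a 1, pos (tag - 14) a 2, pos (tag - 14) a 3,
        pos (tag - 14) a 4]
    else taut
  else taut

def clause (t : ℕ) : List ℕ := clauseA (t % 64) (t / 64 % 64) (t / 4096 % 64) (t / 262144 % 64)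

/-- Membership of a literal in a bit mask. -/
def has (m l : ℕ) : Bool := Nat.beq (Nat.land (Nat.shiftRight m l) 1) 1
def ins (m l : ℕ) : ℕ := Nat.lor m (Nat.shiftLeft 1 l)

def check : List ℕ → ℕ → List ℕ → Bool
  | [], _, _ => false
  | t :: ts, m, st =>
    if t % 64 = 0 then check ts (ins m (t / 64)) (ins m (flip (t / 64)) :: st)
    else match (clause t).filter (fun l => !has m (flip l)) with
      | [] => match st with
        | [] => true
        | m' :: st' => check ts m' st'
      | [l] => check ts (ins m l) st
      | _ => false

theorem has_iff (m l : ℕ) : has m l = true ↔ m.testBit l = true := by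
  have : Nat.land (Nat.shiftRight m l) 1 = (m >>> l) % 2 := Nat.and_one_is_mod _
  rw [has, this, Nat.testBit_eq_decide_div_mod_eq, Nat.shiftRight_eq_div_pow]
  simp

theorem has_ins (m l k : ℕ) (h : has (ins m l) k = true) : has m k = true ∨ k = l := by
  rw [has_iff] at *
  have e : ins m l = m ||| (1 <<< l) := rfl
  rw [e, Nat.testBit_or, Bool.or_eq_true] at h
  rcases h with h | h
  · exact Or.inl h
  · right
    rw [Nat.one_shiftLeft, Nat.testBit_two_pow] at h
    simpa [eq_comm] using h

theorem ev_flip (f : ℕ → ℕ) (l : ℕ) : ev f (flip l) ↔ ¬ ev f l := by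
  unfold ev flip
  by_cases h : l % 2 = 0
  · have h1 : (l + 1) % 2 ≠ 0 := by omega
    have h2 : (l + 1) / 8192 = l / 8192 := by omega
    have h3 : (l + 1) / 128 = l / 128 := by omega
    have h4 : (l + 1) / 2 = l / 2 := by omega
    simp [h, h1, h2, h3, h4]
  · have h1 : (l - 1) % 2 = 0 := by omega
    have h2 : (l - 1) / 8192 = l / 8192 := by omega
    have h3 : (l - 1) / 128 = l / 128 := by omega
    have h4 : (l - 1) / 2 = l / 2 := by omega
    simp [h, h1, h2, h3, h4]

theorem ev_pos (f : ℕ → ℕ) (t i j : ℕ) (hi : i < 64) (hj : j < 64) :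
    ev f (pos t i j) ↔ V f t i j := by
  unfold ev pos
  rw [if_pos (by omega), show 2 * ((t * 64 + i) * 64 + j) / 8192 = t by omega,
    show 2 * ((t * 64 + i) * 64 + j) / 128 % 64 = i by omega,
    show 2 * ((t * 64 + i) * 64 + j) / 2 % 64 = j by omega]

theorem ev_neg (f : ℕ → ℕ) (t i j : ℕ) (hi : i < 64) (hj : j < 64) :
    ev f (neg t i j) ↔ ¬ V f t i j := by
  unfold ev neg
  rw [if_neg (by omega), show (2 * ((t * 64 + i) * 64 + j) + 1) / 8192 = t by omega,
    show (2 * ((t * 64 + i) * 64 + j) + 1) / 128 % 64 = i by omega,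
    show (2 * ((t * 64 + i) * 64 + j) + 1) / 2 % 64 = j by omega]

theorem V_lt (f : ℕ → ℕ) (i j : ℕ) : V f 0 i j ↔ f i < f j := by simp [V]

theorem V_same (f : ℕ → ℕ) (q i j : ℕ) (hq : q < 5) :
    V f (1 + q) i j ↔ Same f (dOf q) i j := by
  simp only [V]
  rw [if_neg (by omega), if_pos (by omega), show 1 + q - 1 = q by omega]

theorem V_ns (f : ℕ → ℕ) (i j : ℕ) : V f 6 i j ↔ NS f i j := by simp [V]

theorem V_cv (f : ℕ → ℕ) (v i j : ℕ) : V f (7 + v) i j ↔ CV f (v / 2) (v % 2) i j := by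
  simp only [V]
  rw [if_neg (by omega), if_neg (by omega), if_neg (by omega), show 7 + v - 7 = v by omega]

theorem ev_lt {f : ℕ → ℕ} (H : Hyp f) (i j : ℕ) (hi : i < 38) (hj : j < 38) (hij : i ≠ j) :
    ev f (lt i j) ↔ f i < f j := by
  unfold lt
  have h : f i ≠ f j := fun h => hij (H.inj i j hi hj h)
  split_ifs
  · rw [ev_pos _ _ _ _ (by omega) (by omega), V_lt]
  · rw [ev_neg _ _ _ _ (by omega) (by omega), V_lt]
    omega

theorem taut_sound (f : ℕ → ℕ) : ∃ l ∈ taut, ev f l := by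
  by_cases h : ev f 0
  · exact ⟨0, by simp [taut], h⟩
  · exact ⟨1, by simp [taut], (ev_flip f 0).2 h⟩

theorem dOf_cases {q : ℕ} (hq : q < 5) : 2 ≤ dOf q ∧ dOf q ≤ 16 := by
  unfold dOf; split_ifs <;> omega

theorem clauseB_sound {f : ℕ → ℕ} (H : Hyp f) (v a b c : ℕ) (first : Bool) (hv : v < 4) :
    ∃ l ∈ clauseB v a b c first, ev f l := by
  unfold clauseB
  simp only
  split_ifs with h1 h2 h3 h4 h4 h3
  all_goals try exact taut_sound f
  all_goals
    obtain ⟨ha, hb, hc1, hc2⟩ := h1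
    have hd := dOf_cases hb
    have hne : piv (v / 2) b ≠ par (v / 2) b c ∧ piv (v / 2) b < 38 ∧ par (v / 2) b c < 38
        ∧ c < 38 := by
      unfold piv par; unfold lo2 at hc1 hc2
      split_ifs at * <;> omega
    obtain ⟨hne, hp, hr, hc⟩ := hne
    have hpr : f (piv (v / 2) b) ≠ f (par (v / 2) b c) := fun h => hne (H.inj _ _ hp hr h)
    by_cases hcv : CV f (v / 2) (v % 2) a b
    swap
    · exact ⟨neg (7 + v) a b, by simp, by
        rw [ev_neg _ _ _ _ (by omega) (by omega), V_cv]; exact hcv⟩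
    have hcv2 := hcv.2 c hc1 hc2
    simp only [List.exists_mem_cons_iff, List.not_mem_nil, false_and, exists_false, or_false]
  · right
    subst h2
    rw [ev_lt H _ _ hp hr hne]
    omega
  · right
    subst h2
    rw [ev_lt H _ _ hr hp hne.symm]
    omega
  · right
    have hac : f c ≠ f a := fun h => h2 (H.inj _ _ hc ha h)
    rw [ev_lt H _ _ hp hr hne, ev_lt H _ _ hc ha h2]
    omega
  · right
    have hac : f c ≠ f a := fun h => h2 (H.inj _ _ hc ha h)
    rw [ev_lt H _ _ hr hp hne.symm, ev_lt H _ _ ha hc (Ne.symm h2)]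
    omega

theorem clauseA_sound {f : ℕ → ℕ} (H : Hyp f) (tag a b c : ℕ) :
    ∃ l ∈ clauseA tag a b c, ev f l := by
  unfold clauseA
  simp only
  split_ifs with t1 h1 t2 h2 t3 t4 t5 t6 h6 t7 h7 t8 h8 t9 t10 t11 h11
  all_goals try exact taut_sound f
  · obtain ⟨ha, hb, hc, hab, hbc, hac⟩ := h1
    simp only [List.exists_mem_cons_iff, List.not_mem_nil, false_and, exists_false, or_false]
    have h : f b ≠ f c := fun h => hbc (H.inj _ _ hb hc h)
    rw [ev_lt H _ _ hb ha hab.symm, ev_lt H _ _ hc hb hbc.symm, ev_lt H _ _ ha hc hac]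
    have h' : f a ≠ f b := fun h => hab (H.inj _ _ ha hb h)
    omega
  · obtain ⟨hab, hb, hc⟩ := h2
    have hd := dOf_cases hc
    simp only [List.exists_mem_cons_iff, List.not_mem_nil, false_and, exists_false, or_false]
    rw [ev_neg _ _ _ _ (by omega) (by omega), ev_neg _ _ _ _ (by omega) (by omega),
      ev_pos _ _ _ _ (by omega) (by omega), V_same _ _ _ _ hc, V_lt, V_lt, Same]
    tauto
  · obtain ⟨hab, hb, hc⟩ := h2
    have hd := dOf_cases hc
    simp only [List.exists_mem_cons_iff, List.not_mem_nil, false_and, exists_false, or_false]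
    rw [ev_neg _ _ _ _ (by omega) (by omega), ev_pos _ _ _ _ (by omega) (by omega),
      ev_neg _ _ _ _ (by omega) (by omega), V_same _ _ _ _ hc, V_lt, V_lt, Same]
    tauto
  · obtain ⟨hab, hb, hc⟩ := h2
    have hd := dOf_cases hc
    simp only [List.exists_mem_cons_iff, List.not_mem_nil, false_and, exists_false, or_false]
    rw [ev_pos _ _ _ _ (by omega) (by omega), ev_pos _ _ _ _ (by omega) (by omega),
      ev_pos _ _ _ _ (by omega) (by omega), V_same _ _ _ _ hc, V_lt, V_lt, Same]
    tauto
  · obtain ⟨hab, hb, hc⟩ := h2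
    have hd := dOf_cases hc
    simp only [List.exists_mem_cons_iff, List.not_mem_nil, false_and, exists_false, or_false]
    rw [ev_pos _ _ _ _ (by omega) (by omega), ev_neg _ _ _ _ (by omega) (by omega),
      ev_neg _ _ _ _ (by omega) (by omega), V_same _ _ _ _ hc, V_lt, V_lt, Same]
    tauto
  · obtain ⟨i, j, hi, hij, hj, hs⟩ := H.nosq b a h6.1 h6.2
    refine ⟨neg (1 + b) i j, ?_, ?_⟩
    · simp only [sqClause, List.mem_flatMap, List.mem_range, List.mem_map]
      exact ⟨j - a, by omega, i - a, by omega, by congr 1 <;> omega⟩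
    · have := dOf_cases h6.1
      rw [ev_neg _ _ _ _ (by omega) (by omega), V_same _ _ _ _ h6.1]
      exact hs
  · obtain ⟨h1, h2, h3, h4, h5⟩ := h7
    simp only [List.exists_mem_cons_iff, List.not_mem_nil, false_and, exists_false, or_false]
    rw [ev_neg _ _ _ _ (by omega) (by omega), ev_pos _ _ _ _ (by omega) (by omega),
      V_same _ _ _ _ h5, V_ns]
    by_cases h : NS f (tag - 7) c
    · exact Or.inr (h a b h1 h2 h3)
    · exact Or.inl h
  · simp only [List.exists_mem_cons_iff, List.not_mem_nil, false_and, exists_false, or_false]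
    rw [ev_neg _ _ _ _ (by omega) (by omega), ev_pos _ _ _ _ (by omega) (by omega),
      V_cv, V_ns]
    by_cases h : CV f ((tag - 9) / 2) ((tag - 9) % 2) a b
    · exact Or.inr h.1
    · exact Or.inl h
  · exact clauseB_sound H _ _ _ _ _ (by omega)
  · exact clauseB_sound H _ _ _ _ _ (by omega)
  · obtain ⟨q, hq, h⟩ := H.cover ((tag - 21) / 2) ((tag - 21) % 2) a (by omega) (by omega) h11
    refine ⟨pos (tag - 14) a q, ?_, ?_⟩
    · interval_cases q <;> simp
    · rw [ev_pos _ _ _ _ (by omega) (by omega), show tag - 14 = 7 + (tag - 21) by omega, V_cv]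
      exact h

theorem clause_sound {f : ℕ → ℕ} (H : Hyp f) (t : ℕ) : ∃ l ∈ clause t, ev f l :=
  clauseA_sound H _ _ _ _

/-- All literals of the mask hold. -/
def Holds (f : ℕ → ℕ) (m : ℕ) : Prop := ∀ l, has m l = true → ev f l

theorem Holds.ins {f : ℕ → ℕ} {m l : ℕ} (h : Holds f m) (hl : ev f l) : Holds f (ins m l) := by
  intro k hk
  rcases has_ins _ _ _ hk with h1 | rfl
  · exact h k h1
  · exact hl

theorem check_sound {f : ℕ → ℕ} (H : Hyp f) : ∀ (ts : List ℕ) (m : ℕ) (st : List ℕ),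
    check ts m st = true → ∀ m' ∈ m :: st, ¬ Holds f m' := by
  intro ts
  induction ts with
  | nil => intro m st h; simp [check] at h
  | cons t ts ih =>
    intro m st h
    rw [check.eq_def] at h
    dsimp only at h
    by_cases ht : t % 64 = 0
    · rw [if_pos ht] at h
      have h' := ih _ _ h
      intro m' hm'
      rcases List.mem_cons.1 hm' with rfl | hm'
      · intro hm
        by_cases hl : ev f (t / 64)
        · exact h' _ (by simp) (hm.ins hl)
        · exact h' (NB38.ins m' (flip (t / 64))) (by simp) (hm.ins ((ev_flip _ _).2 hl))
      · exact h' _ (by simp [hm'])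
    · rw [if_neg ht] at h
      have key : Holds f m →
          ∃ l ∈ (clause t).filter (fun l => !has m (flip l)), ev f l := by
        intro hm
        obtain ⟨l, hl, hev⟩ := clause_sound H t
        refine ⟨l, List.mem_filter.2 ⟨hl, ?_⟩, hev⟩
        cases hh : has m (flip l)
        · rfl
        · exact absurd hev ((ev_flip _ _).1 (hm _ hh))
      generalize (clause t).filter (fun l => !has m (flip l)) = c at h key
      match c, st with
      | [], [] =>
        intro m' hm'
        obtain rfl : m' = m := by simpa using hm'
        intro hm
        obtain ⟨l, hl, _⟩ := key hm
        simp at hl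
      | [], m1 :: st1 =>
        intro m' hm'
        rcases List.mem_cons.1 hm' with rfl | hm'
        · intro hm
          obtain ⟨l, hl, _⟩ := key hm
          simp at hl
        · exact ih _ _ h m' hm'
      | [l], st =>
        have h' := ih _ _ h
        intro m' hm'
        rcases List.mem_cons.1 hm' with rfl | hm'
        · intro hm
          obtain ⟨l', hl, hev⟩ := key hm
          obtain rfl : l' = l := by simpa using hl
          exact h' _ (by simp) (hm.ins hev)
        · exact h' _ (by simp [hm'])
      | _ :: _ :: _, _ => simp at h

/-- The refutation: case distinctions and unit propagations, in depth-first order. -/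
def cert : List ℕ :=
  [
   6, 70, 134, 198, 262, 326, 390, 454, 518, 582, 646, 710, 774, 838, 902, 966, 1030, 1094, 1158,
   1222, 1286, 1350, 1414, 1478, 1542, 1606, 1670, 1734, 1798, 1862, 1926, 1990, 2054, 2118, 2182,
   128, 4101, 12420, 20741, 266245, 29060, 274564, 37381, 282885, 45700, 291204, 54021, 299525,
   62340, 307844, 70661, 316165, 78980, 324484, 87301, 332805, 95620, 341124, 103941, 349445,
   112260, 357764, 120581, 366085, 128900, 137221, 382725, 145540, 391044, 399365, 8448, 528385,
   8261, 83, 84, 147, 148, 536833, 16580, 1593601, 24901, 1602049, 33220, 278724, 278660, 2658817,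
   41541, 287045, 286981, 2667265, 49860, 295364, 295300, 3724033, 58181, 303685, 303621, 3732481,
   66500, 312004, 311940, 4789249, 74821, 320325, 320261, 4797697, 83140, 328644, 328580, 5854465,
   91461, 336965, 336901, 5862913, 99780, 345284, 345220, 6919681, 108101, 353605, 353541, 6928129,
   116420, 361924, 361860, 7984897, 124741, 7993345, 133060, 378564, 9050113, 141381, 386885,
   386821, 9058561, 9701714, 395204, 395140, 3956864, 6345, 9181389, 9705677, 399303, 7993473,
   9058625, 6022, 9049985, 399236, 4481152, 6346, 9705678, 399303, 9058625, 399298, 6022, 399236,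
   7993409, 3154432, 1060872, 1060936, 1065032, 1069192, 1073288, 1069256, 1073352, 1085832,
   1085896, 1089992, 1102280, 1106376, 1102472, 1106568, 1102536, 1106632, 3146240, 1119175,
   1123271, 1135751, 1135815, 3957120, 8927437, 9189581, 9713869, 6919553, 6919617, 9058625,
   1135810, 1135746, 349380, 349316, 5254, 4472960, 6282, 9181330, 9705614, 399303, 1123267, 6022,
   399236, 7993409, 1119171, 399298, 1135811, 5854401, 332741, 336837, 5062, 4481280, 10442,
   8923342, 9185490, 9709774, 632263, 8923282, 9185485, 9058625, 9701585, 9701522, 2261, 8931533,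
   9193677, 8931474, 2198, 14474, 9189522, 877767, 632258, 877763, 25408, 536961, 1593537, 1073347,
   1593473, 1069251, 9193682, 1069187, 1135811, 9701586, 2262, 14538, 8927438, 890311, 6919553,
   890306, 349316, 349380, 5254, 528532, 1073346, 9193677, 3146112, 861127, 877767, 890311, 877762,
   1123267, 540820, 861122, 9185485, 1106627, 2261, 536724, 9701585, 152, 890307, 270484, 1085891,
   14474, 14538, 17216, 1593473, 1073283, 1069187, 8931474, 1135747, 9701522, 2198, 10378, 8923282,
   9185426, 644807, 8923341, 1106563, 1106627, 2261, 548995, 536724, 9701585, 549000, 1135811,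
   644803, 8331, 8332, 1069251, 1102531, 152, 266387, 274579, 540820, 151, 540815, 1581057, 528787,
   1073282, 528788, 403, 404, 8931534, 2262, 9701586, 1135811, 1069251, 266387, 58624, 286917,
   532884, 532883, 4294, 282821, 823747, 823752, 12683, 12684, 407, 408, 1589647, 1589652, 532623,
   827843, 827848, 12427, 12428, 12684, 151, 540815, 540820, 541076, 152, 408, 1581200, 1581460,
   18377, 18569, 18633, 18378, 18570, 18634, 18762, 3956992, 8923341, 9185485, 9709773, 7984769,
   9185490, 7984833, 9701586, 2262, 14538, 8927438, 890311, 6919553, 890306, 365956, 366020, 5510,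
   291520, 9058625, 9701585, 9701586, 9701522, 2261, 8927437, 9189581, 8927378, 9189586, 2262,
   10442, 8923342, 632263, 8923282, 632259, 2198, 9181330, 3146112, 890311, 890307, 6919617,
   1085891, 1089987, 270483, 270484, 25344, 528532, 1073346, 353477, 5318, 349381, 4797761, 823746,
   823752, 12428, 152, 278676, 3732545, 332740, 332676, 4998, 536961, 528527, 1593537, 1073347,
   1593473, 1069251, 827842, 1069187, 827848, 12427, 151, 278675, 3732545, 332740, 332676, 4998,
   14281, 14473, 14282, 14474, 14666, 3924224, 10185, 8136653, 9709517, 644807, 8136658, 9701330,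
   9844673, 644803, 2006, 9185233, 6090, 9181138, 399303, 386757, 399299, 5830, 382661, 3948800,
   10377, 8923277, 9185425, 9709709, 644807, 8923282, 9701522, 644803, 2198, 6282, 9181330, 399303,
   386757, 399299, 5830, 382661, 3154304, 798728, 798792, 802888, 8576, 790529, 1060930, 798786,
   1060866, 798722, 324421, 324357, 4870, 274689, 1060931, 798787, 1065027, 802883, 324420, 328516,
   4934, 12427, 12364, 12428, 12620, 12684, 258240, 399299, 399303, 6089, 6281, 6474, 2005, 2197,
   2390, 9701329, 9701521, 10570, 8137042, 628167, 644551, 644743, 1106371, 628162, 644547, 644739,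
   1581460, 5862977, 1085890, 1102275, 1102467, 1085826, 1319252, 17024, 1318913, 1318977, 1593473,
   536897, 1593345, 340, 266580, 536961, 528788, 404, 344, 408, 1589584, 1589652, 544899, 1319060,
   282756, 544904, 4230, 8268, 282820, 266324, 266388, 88, 152, 540752, 540820, 9050049, 91776,
   3723969, 1102530, 1106626, 382661, 386757, 5830, 2667329, 58560, 1602113, 299460, 299396, 4486,
   270483, 270484, 25344, 528532, 152, 278676, 3732545, 316100, 316036, 4742, 528527, 151, 278675,
   3732545, 316100, 316036, 4742, 16459, 16460, 16524, 3154304, 798728, 798792, 802888, 3154240,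
   8267, 8268, 8332, 25216, 266324, 266388, 88, 152, 536656, 536724, 266319, 87, 274511, 274516,
   274580, 88, 152, 528464, 528532, 536584, 536648, 540744, 8576, 790529, 798786, 536642, 798722,
   536578, 307781, 307717, 4614, 274689, 798787, 536643, 802883, 540739, 307780, 311876, 4678,
   12363, 12364, 12428, 25216, 266324, 266388, 88, 152, 532560, 532628, 266319, 87, 270415, 270420,
   270484, 88, 152, 528464, 528532, 270529, 8260, 15, 1327297, 16581, 1335745, 24900, 270404,
   274500, 2392513, 33221, 278725, 282821, 2400961, 41540, 287044, 3457729, 49861, 3466177, 58180,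
   303684, 307780, 4522945, 66501, 312005, 316101, 4531393, 74820, 320324, 324420, 5588161, 83141,
   328645, 332741, 5596609, 91460, 336964, 341060, 6653377, 99781, 345285, 349381, 6661825, 108100,
   353604, 357700, 116421, 7727041, 124740, 133061, 8792257, 141380, 386884, 390980, 9849025,
   9701709, 9701645, 9701646, 9701581, 9701582, 4735104, 4235, 4243, 270344, 8385, 270339, 4102,
   274436, 1073601, 5259392, 4236, 4244, 270344, 8385, 270339, 4102, 274436, 1073601, 3146240,
   1089991, 1094087, 1098183, 1106375, 1090055, 1094151, 1106439, 1106631, 1106695, 1110791,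
   1123271, 1127367, 1131463, 1135559, 1123335, 1127431, 1131527, 3154432, 1056776, 1060872,
   1064968, 1073160, 1073352, 1073416, 4735360, 12427, 12435, 798867, 794632, 8385, 1056771,
   794627, 3982017, 1060867, 320260, 324356, 4870, 125248, 540815, 4785089, 1123267, 1056770,
   9181457, 9181521, 143, 151, 8331, 532623, 532488, 1089986, 532483, 632258, 1090051, 632263,
   9451857, 10505, 10569, 2389, 9193809, 9455953, 877762, 9455885, 877767, 2325, 14601, 540820,
   1123266, 9181389, 3154304, 794632, 811208, 811272, 827848, 811203, 1073346, 9193677, 336837,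
   827843, 5062, 1089986, 9189581, 2261, 9447629, 1106690, 794626, 1056771, 336900, 811266,
   1073411, 12299, 12491, 12683, 12428, 12556, 12684, 320, 8385, 143, 144, 1056771, 207, 152,
   1123331, 532628, 9443665, 532623, 532687, 1089987, 151, 9189713, 632259, 802963, 632263, 803023,
   10569, 215, 2389, 4299, 9455953, 270344, 1073411, 270339, 1056770, 1123330, 9443597, 33536,
   1589441, 1073410, 1073346, 336901, 336837, 5062, 1073411, 270338, 877827, 270344, 877831, 4107,
   4491, 4364, 4492, 14281, 14601, 14282, 125696, 8144845, 4019585, 1589524, 4015489, 1135554,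
   1131458, 9701325, 9701326, 9443277, 9443278, 2005, 10185, 8136653, 640455, 8136658, 8136977,
   640451, 2006, 2325, 1098179, 8406990, 1057044, 8407313, 280, 1131522, 272, 1064962, 1589647,
   5833665, 1073154, 399, 400, 407, 8587, 1581455, 548872, 1581460, 1581075, 548867, 408, 23,
   1106435, 1065360, 1064979, 1131458, 1064962, 8145169, 1131522, 2325, 8399121, 16395, 16523,
   16587, 16779, 16524, 16588, 16780, 4735232, 8331, 8339, 532623, 794771, 549064, 8385, 144,
   532628, 794831, 207, 152, 536724, 536783, 549058, 215, 528591, 320, 143, 144, 151, 12427,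
   536719, 798867, 794632, 536724, 3982017, 794627, 152, 532628, 794772, 2654657, 2916801, 303620,
   307716, 4614, 3154304, 794632, 811208, 811272, 815368, 794626, 3719873, 1106690, 1106626,
   9447693, 9447629, 25344, 811202, 1123266, 320197, 9181389, 4806, 320261, 4269249, 861187,
   861191, 14537, 2261, 9455821, 5334465, 336900, 340996, 5126, 811457, 1589441, 811203, 1851585,
   811267, 1123267, 861123, 815363, 9181457, 861127, 14601, 2325, 9455885, 5334465, 336900, 340996,
   5126, 12299, 12491, 12683, 12492, 12684, 4743424, 8395, 8403, 532687, 794831, 532488, 208,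
   794836, 532482, 216, 4300, 528592, 270344, 286917, 270338, 4294, 286981, 4768000, 8587, 8595,
   1581455, 532488, 400, 1581057, 1581460, 532482, 408, 532879, 4492, 528784, 270344, 286917,
   270338, 4294, 286981, 3146112, 861127, 861191, 865287, 100096, 3719873, 1106690, 1106626,
   861187, 861123, 320261, 320197, 4806, 3204033, 1106691, 1110787, 861186, 865282, 320260, 324356,
   4870, 14281, 14537, 14601, 14282, 14538, 33600, 270338, 270344, 4107, 4299, 4491, 23, 215, 407,
   8203, 207, 399, 548872, 549128, 794639, 548866, 1581071, 549123, 1094082, 1106434, 1106370,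
   3204033, 1106691, 8398797, 8398798, 1110787, 125312, 4007105, 5583809, 1127362, 1123266,
   1135554, 9181133, 9181134, 9701325, 9701326, 2005, 2006, 8144845, 8144850, 5047233, 1127363,
   1127427, 8136909, 636354, 390916, 636359, 5894, 10505, 386820, 9443597, 9443533, 2325, 2261,
   9193745, 9193677, 1589441, 66816, 2654657, 286981, 286917, 4294, 2138817, 1090051, 1094147,
   100160, 3204033, 303620, 307716, 4614, 1106690, 9447629, 9447630, 125184, 1123266, 9181389,
   2261, 9455821, 5334465, 353540, 357636, 5382, 1123267, 9181394, 2262, 9455822, 5334465, 353540,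
   357636, 5382, 18633, 18634, 18698, 3146112, 877767, 877831, 881927, 3146048, 10441, 10442,
   10506, 158464, 877762, 9181389, 2261, 9189581, 9189586, 9189650, 2262, 2326, 9443534, 9443602,
   877763, 9181394, 9181458, 2262, 2326, 9451726, 9451794, 632263, 632327, 636423, 166656, 5850305,
   877826, 877762, 632323, 632259, 353541, 353477, 5318, 5334465, 877827, 881923, 632322, 636418,
   353540, 357636, 5382, 14537, 14538, 14602, 225024, 9185485, 2261, 9181389, 9181394, 9181458,
   2262, 2326, 9447630, 9447698, 9185490, 9185554, 2262, 2326, 9443534, 9443602, 4100, 12421,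
   20740, 266244, 29061, 274565, 37380, 282884, 45701, 291205, 54020, 299524, 62341, 307845, 70660,
   316164, 78981, 324485, 87300, 332804, 95621, 1077637, 341125, 103940, 1085956, 349444, 112261,
   1094277, 357765, 120580, 1102596, 366084, 128901, 1110917, 374405, 137220, 1119236, 382724,
   145541, 1127557, 391045, 1135876, 399364, 8448, 794689, 8261, 20, 803137, 16580, 1859905, 24901,
   270405, 274501, 1868353, 33220, 278724, 282820, 2925121, 41541, 287045, 2933569, 49860, 3990337,
   58181, 303685, 307781, 3998785, 66500, 312004, 316100, 5055553, 74821, 320325, 324421, 5064001,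
   83140, 328644, 332740, 6120769, 91461, 336965, 341061, 6129217, 99780, 345284, 349380, 7185985,
   108101, 353605, 357701, 7194433, 116420, 361924, 366020, 8251201, 124741, 370245, 374341,
   133060, 378564, 9316417, 141381, 386885, 390981, 9324865, 9701714, 9701649, 9701650, 9701585,
   9701586, 4735104, 4235, 4239, 270344, 794625, 270338, 4102, 274437, 1859841, 5259392, 4236,
   4240, 270344, 794625, 270338, 4102, 274437, 1859841, 3146240, 1089991, 1094087, 1098183,
   1106375, 1090055, 1094151, 1106439, 1106631, 1106695, 1110791, 1123271, 1127367, 1131463,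
   1135559, 1123335, 1127431, 1131527, 3154432, 1056776, 1060872, 1064968, 1073160, 1073352,
   1073416, 4735360, 12427, 12431, 798863, 794632, 794625, 1056770, 794626, 2933697, 1060866,
   320261, 324357, 4870, 3956864, 9181389, 9443537, 9181394, 1123266, 9443597, 1123331, 540815,
   1056771, 147, 151, 532623, 1089986, 9189645, 632258, 632263, 10505, 10442, 2325, 9193741,
   9455885, 9193682, 877827, 2262, 877831, 14538, 4489344, 9181454, 9443602, 1123266, 9443597,
   1123331, 540815, 1056771, 147, 151, 532623, 1089986, 9189581, 9189645, 632258, 632263, 10441,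
   10505, 2261, 2325, 9455825, 9455885, 4751488, 4363, 4367, 270344, 12545, 4102, 274437, 803265,
   1859841, 1859777, 1073411, 270338, 1073347, 1056771, 3998849, 336900, 336836, 5062, 5259520,
   8332, 8336, 532628, 532488, 147, 1056770, 532482, 532623, 1089987, 1123330, 1090050, 151,
   9443597, 9451789, 540815, 1123266, 632259, 632263, 10441, 10505, 2325, 9193741, 9455885, 877763,
   9455825, 877767, 2261, 14537, 125184, 5055425, 540820, 3998849, 3998913, 1056771, 148, 152,
   12428, 798864, 794632, 2933697, 794626, 324357, 320261, 4870, 540815, 1123267, 9181394, 3146112,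
   861127, 877767, 877831, 861123, 877762, 9185490, 9193682, 2262, 9189586, 9189581, 9189645,
   632258, 632263, 10441, 10505, 2261, 9455825, 9455885, 877826, 2325, 9443597, 14281, 14537,
   14282, 14538, 14602, 3146048, 10441, 10442, 2261, 2262, 9193677, 9193682, 632263, 640455,
   632327, 632258, 1089986, 532623, 151, 147, 1056771, 1123331, 632322, 1090050, 33600, 803201,
   286980, 286916, 4294, 1073410, 811266, 270339, 811272, 270344, 12555, 12683, 12300, 12684, 4491,
   4108, 4492, 125696, 1589652, 3999105, 1073155, 403, 404, 408, 8588, 1581460, 1057172, 548872,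
   1581455, 1581072, 1098179, 548866, 407, 24, 640451, 1106434, 1065363, 1064976, 8145166, 1064963,
   2326, 1131523, 8399118, 8144850, 5854145, 1589519, 5850049, 1135555, 1131459, 9701329, 9701330,
   640450, 9443281, 9443282, 1098178, 2006, 1057039, 8136658, 279, 8136653, 8136974, 275, 2005,
   2326, 1064963, 8406993, 8407310, 1131523, 16523, 16587, 16779, 16396, 16524, 16588, 16780,
   4735232, 8331, 8335, 532623, 794767, 532488, 148, 532482, 532628, 1868481, 152, 12428, 798864,
   794632, 2933697, 794626, 307717, 303621, 4614, 256, 794625, 147, 148, 212, 151, 536719, 536724,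
   536788, 152, 8332, 794768, 549064, 794836, 549059, 216, 528596, 3154304, 794632, 811208, 811272,
   815368, 794627, 2933633, 1106691, 1106627, 9447633, 9447634, 25344, 1859777, 803201, 811202,
   803265, 811266, 1123266, 861122, 815362, 9181389, 861127, 14537, 2261, 9455825, 6120705, 336901,
   340997, 5126, 811203, 1123267, 320196, 9181394, 4806, 320260, 5055489, 861186, 861191, 14538,
   2262, 9455826, 6120705, 336901, 340997, 5126, 12491, 12683, 12300, 12492, 12684, 4743424, 8395,
   8399, 532691, 794831, 532488, 212, 794836, 532483, 216, 4300, 528596, 270344, 286916, 270339,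
   4294, 286980, 4768000, 8587, 8591, 1581455, 532488, 404, 8577, 1581460, 532483, 408, 532883,
   4492, 528788, 270344, 286916, 270339, 4294, 286980, 3146112, 861127, 861191, 865287, 100096,
   3990273, 1106690, 1110786, 861187, 865283, 320261, 324357, 4870, 2933633, 1106691, 1106627,
   861186, 861122, 320260, 320196, 4806, 14281, 14537, 14282, 14538, 14602, 33536, 270339, 270344,
   4299, 4491, 4108, 215, 407, 24, 211, 403, 8204, 794644, 1581076, 548872, 549128, 1094083,
   1106371, 548867, 549122, 8136658, 1106435, 3990273, 1106690, 8398801, 1110786, 125312, 3998913,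
   1127362, 1127426, 8136914, 636355, 390917, 636359, 5894, 10506, 386821, 9443602, 9443538, 2326,
   2262, 9193742, 9193682, 4011329, 5055425, 1127363, 1135555, 1123267, 9181138, 9181137, 9701329,
   9701330, 2006, 2005, 8144850, 8144845, 803201, 66880, 1868417, 286980, 286916, 4294, 2925057,
   1090050, 1094146, 100096, 3990273, 303621, 307717, 4614, 1106691, 9447633, 9447634, 125184,
   1123266, 9181389, 2261, 9455825, 6120705, 353541, 357637, 5382, 1123267, 9181394, 2262, 9455826,
   6120705, 353541, 357637, 5382, 17865, 18377, 18441, 18633, 18697, 18378, 18634, 18698, 18762,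
   3146112, 861127, 881607, 889799, 861191, 865287, 889863, 889927, 881799, 889991, 877767, 881863,
   890055, 877831, 881927, 886023, 890119, 886087, 126080, 4003393, 3999297, 4027969, 6919105,
   889794, 889922, 6919169, 889858, 881602, 9811585, 9287297, 3858688, 9673, 9709005, 632263,
   636359, 644551, 9819585, 9807297, 9811393, 632259, 644547, 9189586, 636355, 9181394, 9701330,
   9181138, 9189330, 2262, 2006, 8136910, 8136658, 192960, 6174977, 6175041, 9315777, 9283009,
   9188817, 9700817, 1493, 9442769, 9180625, 9443597, 9041793, 9316289, 9181389, 632259, 9037249,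
   632263, 8136913, 10505, 2261, 2325, 9451729, 9451789, 150464, 4814401, 6108289, 881795, 6632577,
   6120641, 881859, 6154433, 890051, 877763, 9181137, 8136653, 8136910, 9701329, 9181394, 2005,
   2262, 7878609, 7878862, 881794, 150848, 6894721, 4007553, 4269697, 7878865, 4273793, 861122,
   861186, 865282, 9185485, 2261, 9443537, 9316353, 386821, 390917, 5894, 150720, 6632577, 889987,
   890051, 7203137, 7465281, 7878990, 7469377, 9185550, 9185614, 2390, 9443662, 9443602, 2326,
   9451794, 7185921, 370181, 374277, 5638, 889986, 175296, 5330497, 6645057, 890115, 4539969,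
   4802113, 7735617, 7997761, 208384, 378437, 5702, 378501, 6932289, 365956, 5510, 361860, 6382913,
   345221, 345157, 5190, 6670145, 7448129, 7710273, 365956, 5510, 361860, 6382913, 345221, 345157,
   5190, 5604929, 886082, 3932416, 10249, 9709581, 640583, 890114, 7735617, 7997761, 640579,
   4539969, 4802113, 378437, 361797, 345157, 5702, 5446, 5190, 378501, 345221, 361860, 166848,
   5064129, 6120705, 5338625, 5338689, 881923, 5076545, 6120641, 881859, 877827, 886019, 890115,
   890051, 877763, 9181138, 9443345, 9701393, 9701330, 2069, 8140813, 9189393, 8140754, 632258,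
   2006, 632263, 10186, 881922, 200128, 7185921, 636419, 9451729, 9451730, 636423, 10441, 10442,
   2261, 2262, 9181389, 9181394, 357637, 5382, 166656, 877826, 353541, 632323, 9451729, 9451730,
   632327, 10441, 10442, 2261, 2262, 9181389, 9181394, 877827, 353540, 9443537, 9443538, 632322,
   632327, 10441, 10442, 2261, 2262, 9189581, 9189586, 889795, 158848, 6632577, 5064257, 889986,
   5338689, 9823937, 9185490, 191744, 7185857, 6129281, 9189646, 6129345, 357637, 5382, 353541,
   877827, 9443602, 632322, 2326, 632327, 10506, 9189586, 2262, 9181394, 9181389, 9181453, 632259,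
   632263, 10441, 10505, 2261, 2325, 9451729, 9451789, 890051, 3146048, 10441, 10505, 10442, 10570,
   158464, 877762, 9181389, 9181518, 9840577, 2261, 2390, 8927566, 8927441, 877763, 9181394, 2262,
   9189586, 9189581, 9189645, 2261, 2325, 9443537, 9443597, 632263, 632327, 636423, 166656,
   6120705, 877826, 881922, 632323, 636419, 353541, 357637, 5382, 5064065, 877827, 877763, 632322,
   632258, 353540, 353476, 5318, 14537, 14601, 14538, 225024, 9185485, 9185549, 2261, 2325,
   9443537, 9443597, 9185490, 2262, 9181394, 9181389, 9181453, 2261, 2325, 9447633, 9447693, 4225,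
   8260, 79, 80, 143, 144, 1060993, 16581, 1069441, 24900, 2126209, 33221, 278725, 278661, 2134657,
   41540, 3191425, 49861, 295365, 295301, 3199873, 58180, 303684, 303620, 4256641, 66501, 312005,
   311941, 4265089, 74820, 320324, 320260, 5321857, 83141, 328645, 328581, 5330305, 91460, 336964,
   336900, 6387073, 99781, 1081797, 345285, 1081733, 345221, 6395521, 108100, 1090116, 353604,
   1090052, 353540, 7452289, 116421, 1098437, 361925, 1098373, 361861, 7460737, 124740, 1106756,
   1106692, 8517505, 133061, 1115077, 378565, 1115013, 8525953, 141380, 1123396, 386884, 1123332,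
   386820, 9582721, 9701709, 1131717, 395205, 1131653, 395141, 3956864, 6345, 9705681, 399303,
   9844865, 6022, 399299, 399237, 8779649, 4481152, 6346, 9181394, 9705682, 399303, 9041793,
   9844865, 6022, 8001665, 399237, 3154432, 1060872, 1060936, 1065032, 1069192, 1073288, 1069256,
   1073352, 1085832, 1089928, 1094024, 1098120, 1102216, 1106312, 1085896, 1089992, 1094088,
   1098184, 1102280, 1106376, 1094152, 1098248, 1102344, 1106440, 1094216, 1098312, 1102408,
   1106504, 1102472, 1106568, 1102536, 1106632, 3146240, 1110471, 1114567, 1118663, 1122759,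
   1126855, 1130951, 1135047, 1110535, 1114631, 1118727, 1122823, 1126919, 1131015, 1135111,
   1110599, 1114695, 1118791, 1122887, 1126983, 1131079, 1135175, 1110663, 1114759, 1118855,
   1122951, 1127047, 1131143, 1135239, 1110727, 1114823, 1118919, 1123015, 1127111, 1131207,
   1135303, 1110791, 1114887, 1118983, 1123079, 1127175, 1131271, 1135367, 1110855, 1114951,
   1119047, 1123143, 1127239, 1131335, 1135431, 1119111, 1123207, 1127303, 1131399, 1135495,
   1119175, 1123271, 1127367, 1131463, 1135559, 1127431, 1131527, 1135623, 1127495, 1131591,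
   1135687, 1135751, 1135815, 3948672, 6281, 9181325, 9705617, 399303, 1123266, 6022, 399237,
   8779649, 1119170, 399299, 1135810, 5068161, 332740, 336836, 5062, 3957120, 14537, 8927441,
   9713873, 890311, 5871233, 9844865, 1135811, 890307, 1135747, 349381, 349317, 5254, 25344,
   1585281, 807297, 1073346, 545153, 1069250, 9193677, 9193613, 1069186, 1135810, 1135746, 9701581,
   9701517, 2261, 10441, 8923345, 632263, 8923277, 2197, 14473, 9189517, 877767, 632259, 877762,
   528527, 1073347, 9193682, 3146112, 861127, 877767, 890247, 890311, 877763, 1123266, 540815,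
   861123, 1106626, 536719, 151, 270479, 2388353, 1085890, 1085826, 890306, 890242, 1135811,
   1135747, 349381, 349317, 5254, 14473, 14474, 14538, 17152, 545153, 1073282, 1069186, 8931469,
   1135746, 9701517, 2197, 10377, 8923277, 9185421, 644807, 8923346, 1106562, 1106626, 2262,
   548994, 536719, 9701582, 549000, 1135810, 644802, 8331, 8332, 1069250, 1102530, 151, 266384,
   274576, 540815, 152, 540820, 270721, 528783, 8577, 1073283, 528784, 399, 400, 8931474, 3154304,
   811208, 827848, 811203, 827842, 540815, 541071, 532623, 532879, 151, 407, 1585299, 1585551,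
   12427, 12683, 12684, 59136, 3699073, 1581460, 3989889, 4252033, 1106306, 408, 8250753, 8512897,
   1327504, 1065360, 803216, 541072, 278928, 1110405, 1114501, 1135554, 5566849, 1131458, 5304705,
   1127362, 5042561, 1123266, 4780417, 1119170, 4518273, 9827713, 1134981, 9565569, 1130885,
   9303425, 1126789, 9041281, 1122693, 8779137, 1118597, 16774, 1581455, 1106371, 407, 1589647,
   541071, 1589652, 1589395, 1123266, 408, 151, 9181326, 8136850, 1319312, 1319059, 2198, 1069186,
   9701518, 1135746, 18377, 18569, 18633, 18761, 18378, 18634, 3956992, 10441, 8923345, 9185485,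
   9709777, 632263, 8923277, 9185490, 9844865, 9701582, 9701517, 2262, 8927442, 9189586, 8927373,
   632258, 2197, 9181325, 291456, 9701581, 9701582, 2261, 14537, 8927441, 9189581, 890311, 5871233,
   9189586, 890307, 2262, 8923346, 9185490, 6936449, 7198593, 365957, 366021, 5510, 3146112,
   890311, 890306, 6133377, 1085890, 1089986, 270415, 270479, 25344, 1585281, 528467, 807297,
   1073346, 545153, 1069250, 827843, 1069186, 827848, 12363, 87, 278607, 4518785, 332741, 332677,
   4998, 528527, 1073347, 353476, 5318, 349380, 5584001, 823747, 823752, 12427, 151, 278671,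
   4518785, 332741, 332677, 4998, 14281, 14473, 14665, 14282, 3924224, 10185, 8136653, 9709521,
   644807, 8136658, 9701326, 8272193, 644802, 2006, 9185229, 6090, 9181134, 399303, 386756, 399298,
   5830, 382660, 3948800, 10377, 8923277, 9185421, 9709713, 644807, 8923473, 644802, 2389, 6473,
   9181517, 399303, 386756, 399298, 5830, 382660, 3154304, 798728, 798792, 802888, 8576, 1060929,
   1060930, 798786, 1065026, 802882, 324421, 328517, 4934, 4289, 1060931, 798787, 1060867, 798723,
   324420, 324356, 4870, 12363, 12427, 12619, 12683, 12428, 258176, 399298, 399303, 6089, 6281,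
   6473, 2005, 2197, 2389, 9701325, 9701517, 10569, 8137037, 628167, 644551, 644743, 1106370,
   628163, 644546, 644738, 1581455, 6649217, 1085891, 1102274, 1102466, 1085827, 1319247, 17024,
   544898, 1319055, 282757, 544904, 4230, 8267, 282821, 266319, 266383, 87, 151, 540755, 540815,
   270657, 1323137, 8513, 545153, 266575, 807297, 335, 20865, 528783, 343, 399, 407, 1589587,
   1589647, 8263809, 91840, 2937729, 1102531, 1106627, 382660, 386756, 5830, 3453569, 58496,
   2388353, 299461, 299397, 4486, 270479, 270480, 25344, 528532, 152, 278672, 4518785, 316101,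
   316037, 4742, 528527, 151, 278671, 4518785, 316101, 316037, 4742, 16459, 16523, 16460, 3154304,
   798728, 798792, 802888, 3154240, 8267, 8331, 8268, 25216, 266324, 88, 274516, 274511, 274575,
   87, 151, 528467, 528527, 266319, 266383, 87, 151, 536659, 536719, 536584, 536648, 540744, 8576,
   1060929, 798786, 536642, 802882, 540738, 307781, 311877, 4678, 4289, 798787, 536643, 798723,
   536579, 307780, 307716, 4614, 12363, 12427, 12364, 25216, 266324, 88, 270420, 270415, 270479,
   87, 151, 528467, 528527, 266319, 266383, 87, 151, 532563, 532623]

theorem check_cert : check cert 0 [] = true := by decide +kernel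

theorem no_hyp (f : ℕ → ℕ) : ¬ Hyp f := by
  intro H
  refine check_sound H _ _ _ check_cert 0 (by simp) ?_
  intro l hl
  rw [has_iff] at hl
  simp at hl

/-! ### A bicrucial permutation satisfies the conditions -/

/-- Squares of sequences. -/
def Sq (N : ℕ) (f : ℕ → ℕ) (k d : ℕ) : Prop :=
  k + 2 * d ≤ N ∧ ∀ i j, i < d → j < d → (f (k + i) < f (k + j) ↔ f (k + d + i) < f (k + d + j))

theorem sq_mod {N : ℕ} {f : ℕ → ℕ} (inj : ∀ i j, i < N → j < N → f i = f j → i = j)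
    {k d : ℕ} (hd : 2 ≤ d) (h : Sq N f k d) : (∃ k', Sq N f k' 2) ∨ d % 4 = 0 := by
  by_contra hcon
  push Not at hcon
  obtain ⟨h2, hmod⟩ := hcon
  have step : ∀ i, i + 4 ≤ N → (f (i + 2) < f (i + 3) ↔ ¬ f i < f (i + 1)) := by
    intro i hi
    by_contra hc
    apply h2 i
    refine ⟨by omega, ?_⟩
    have n1 : f i ≠ f (i + 1) := fun e => by have := inj _ _ (by omega) (by omega) e; omega
    have n2 : f (i + 2) ≠ f (i + 3) := fun e => by
      have := inj _ _ (by omega) (by omega) e; omega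
    intro a b ha hb
    interval_cases a <;> interval_cases b <;> simp [add_assoc] <;> omega
  have per : ∀ m i, i + 4 * m + 2 ≤ N →
      (f (i + 4 * m) < f (i + 4 * m + 1) ↔ f i < f (i + 1)) := by
    intro m
    induction m with
    | zero => intro i _; simp
    | succ m ih =>
      intro i hi
      have h1 := ih i (by omega)
      have h3 := step (i + 4 * m) (by omega)
      have h4 := step (i + 4 * m + 2) (by omega)
      rw [show i + 4 * (m + 1) = i + 4 * m + 2 + 2 by omega]
      rw [show i + 4 * m + 2 + 2 + 1 = i + 4 * m + 2 + 3 by omega, h4,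
        show i + 4 * m + 2 + 1 = i + 4 * m + 3 by omega, h3, h1, not_not]
  obtain ⟨hb, hs⟩ := h
  have e0 := hs 0 1 (by omega) (by omega)
  have hdm : d = 4 * (d / 4) + d % 4 := by omega
  have hlt : d % 4 < 4 := Nat.mod_lt _ (by omega)
  generalize d / 4 = m at hdm
  generalize d % 4 = r at hdm hlt hmod
  have p0 := per m k (by omega)
  have p1 := per m (k + 1) (by omega)
  interval_cases r
  · exact hmod rfl
  · have e1 := hs 1 2 (by omega) (by omega)
    have s0 := step (k + 4 * m) (by omega)
    subst hdm
    have q1 : k + (4 * m + 1) + 0 = k + 1 + 4 * m := by omega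
    have q2 : k + (4 * m + 1) + 1 = k + 4 * m + 2 := by omega
    have q3 : k + (4 * m + 1) + 2 = k + 4 * m + 3 := by omega
    have q4 : k + 1 + 4 * m + 1 = k + 4 * m + 2 := by omega
    have q5 : k + 1 + 1 = k + 2 := by omega
    rw [q1, q2] at e0
    rw [q2, q3] at e1
    rw [q4, q5] at p1
    simp only [add_zero] at e0
    omega
  · have s0 := step (k + 4 * m) (by omega)
    subst hdm
    have q1 : k + (4 * m + 2) + 0 = k + 4 * m + 2 := by omega
    have q2 : k + (4 * m + 2) + 1 = k + 4 * m + 3 := by omega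
    rw [q1, q2] at e0
    simp only [add_zero] at e0
    omega
  · have e1 := hs 1 2 (by omega) (by omega)
    have s0 := step (k + 4 * m) (by omega)
    have s1 := step (k + 1 + 4 * m) (by omega)
    have p2 := per (m + 1) k (by omega)
    subst hdm
    have q1 : k + (4 * m + 3) + 0 = k + 4 * m + 3 := by omega
    have q2 : k + (4 * m + 3) + 1 = k + 4 * m + 4 := by omega
    have q3 : k + (4 * m + 3) + 2 = k + 4 * m + 5 := by omega
    have q4 : k + 1 + 4 * m + 2 = k + 4 * m + 3 := by omega
    have q5 : k + 1 + 4 * m + 3 = k + 4 * m + 4 := by omega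
    have q6 : k + 4 * (m + 1) = k + 4 * m + 4 := by omega
    have q7 : k + 1 + 1 = k + 2 := by omega
    have q8 : k + 4 * m + 4 + 1 = k + 4 * m + 5 := by omega
    rw [q1, q2] at e0
    rw [q2, q3] at e1
    rw [q4, q5] at s1
    rw [q7] at p1
    rw [q6, q8] at p2
    simp only [add_zero] at e0
    omega

/-- The value sequence. -/
def seq {n : ℕ} (σ : Fin n → Fin n) (i : ℕ) : ℕ := if h : i < n then (σ ⟨i, h⟩ : ℕ) else 0

theorem seq_lt {n : ℕ} (σ : Fin n → Fin n) {i : ℕ} (h : i < n) : seq σ i = σ ⟨i, h⟩ := dif_pos h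

theorem hasSquareAt_iff {n : ℕ} (σ : Fin n → Fin n) (k l : ℕ) :
    HasSquareAt σ k l ↔ 2 ≤ l ∧ Sq n (seq σ) k l := by
  unfold HasSquareAt Sq
  refine and_congr_right fun _ => ⟨?_, ?_⟩
  · rintro ⟨hb, h⟩
    refine ⟨hb, fun i j hi hj => ?_⟩
    rw [seq_lt σ (show k + i < n by omega), seq_lt σ (show k + j < n by omega),
      seq_lt σ (show k + l + i < n by omega), seq_lt σ (show k + l + j < n by omega)]
    exact h i j hi hj
  · rintro ⟨hb, h⟩
    refine ⟨hb, fun i j hi hj => ?_⟩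
    have := h i j hi hj
    rw [seq_lt σ (show k + i < n by omega), seq_lt σ (show k + j < n by omega),
      seq_lt σ (show k + l + i < n by omega), seq_lt σ (show k + l + j < n by omega)] at this
    exact this

theorem seq_inj {n : ℕ} (σ : Equiv.Perm (Fin n)) (i j : ℕ) (hi : i < n) (hj : j < n)
    (h : seq σ i = seq σ j) : i = j := by
  rw [seq_lt _ hi, seq_lt _ hj] at h
  have := σ.injective (Fin.ext h)
  simpa using this

/-- A square in a permutation may be taken of half-length 2 or a multiple of 4. -/
theorem exists_sq {n : ℕ} (σ : Equiv.Perm (Fin n)) (h : ContainsSquare σ) :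
    ∃ k d, 2 ≤ d ∧ (d = 2 ∨ d % 4 = 0) ∧ Sq n (seq σ) k d := by
  obtain ⟨k, l, h⟩ := h
  rw [hasSquareAt_iff] at h
  obtain ⟨h2, h⟩ := h
  rcases sq_mod (seq_inj σ) h2 h with ⟨k', h'⟩ | h'
  · exact ⟨k', 2, le_rfl, Or.inl rfl, h'⟩
  · exact ⟨k, l, h2, Or.inr h', h⟩

/-- Make room for a new value `x`. -/
def sh (x v : ℕ) : ℕ := if x ≤ v then v + 1 else v

theorem sh_lt (x v w : ℕ) : sh x v < sh x w ↔ v < w := by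
  unfold sh; split_ifs <;> omega

theorem lt_sh (x v : ℕ) : x < sh x v ↔ x ≤ v := by
  unfold sh; split_ifs <;> omega

theorem sh_ne (x v : ℕ) : x ≠ sh x v := by
  unfold sh; split_ifs <;> omega

theorem exists_perm (g : ℕ → ℕ) (hb : ∀ i < 39, g i < 39)
    (inj : ∀ i j, i < 39 → j < 39 → g i = g j → i = j) :
    ∃ π : Equiv.Perm (Fin 39), ∀ i : Fin 39, (π i : ℕ) = g i := by
  have hi : Function.Injective (fun i : Fin 39 => (⟨g i, hb i i.2⟩ : Fin 39)) := by
    intro i j h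
    exact Fin.ext (inj _ _ i.2 j.2 (by simpa using h))
  exact ⟨Equiv.ofBijective _ (Finite.injective_iff_bijective.1 hi), fun i => rfl⟩

theorem exists_q {d : ℕ} (h2 : 2 ≤ d) (h : d = 2 ∨ d % 4 = 0) (hb : 2 * d ≤ 39) :
    ∃ q < 5, dOf q = d := by
  rcases h with rfl | h
  · exact ⟨0, by omega, rfl⟩
  · refine ⟨d / 4, by omega, ?_⟩
    unfold dOf
    rw [if_neg (by omega)]
    omega

theorem sq_congr {N M : ℕ} {f g : ℕ → ℕ} {k k' d : ℕ} (h : Sq N g k d) (hb : k' + 2 * d ≤ M)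
    (hc : ∀ i j, i < 2 * d → j < 2 * d →
      (g (k + i) < g (k + j) ↔ f (k' + i) < f (k' + j))) : Sq M f k' d := by
  refine ⟨hb, fun i j hi hj => ?_⟩
  have h1 := h.2 i j hi hj
  have h2 := hc (d + i) (d + j) (by omega) (by omega)
  rw [hc i j (by omega) (by omega)] at h1
  simp only [← add_assoc] at h2
  rw [h1, h2]

theorem right_cover (σ : Equiv.Perm (Fin 38)) (hσ : RightCrucial σ) (x : ℕ) (hx : x ≤ 38) :
    ∃ q < 5, NS (seq σ) 0 q ∧ ∀ i, lo2 0 q ≤ i → i < lo2 0 q + (dOf q - 1) →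
      (x ≤ seq σ i ↔ seq σ (piv 0 q) < seq σ (par 0 q i)) := by
  have hnos : ¬ ∃ k d, 2 ≤ d ∧ Sq 38 (seq σ) k d := by
    rintro ⟨k, d, h⟩
    exact hσ.1 ⟨k, d, (hasSquareAt_iff _ _ _).2 h⟩
  have hfb : ∀ i < 38, seq σ i < 38 := fun i hi => by
    rw [seq_lt _ hi]; exact (σ ⟨i, hi⟩).2
  have hfi := seq_inj σ
  have hext : ∀ π : Equiv.Perm (Fin 39),
      (∀ i j : Fin 38, π i.castSucc < π j.castSucc ↔ σ i < σ j) → ContainsSquare π := hσ.2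
  have hσf : ∀ i j : Fin 38, σ i < σ j ↔ seq σ i < seq σ j := by
    intro i j
    rw [seq_lt _ i.2, seq_lt _ j.2]
    exact Fin.lt_def
  generalize seq σ = f at *
  let g : ℕ → ℕ := fun i => if i < 38 then sh x (f i) else x
  have g1 : ∀ i, i < 38 → g i = sh x (f i) := fun i hi => if_pos hi
  have g2 : g 38 = x := if_neg (by omega)
  obtain ⟨π, hπ⟩ := exists_perm g
    (by
      intro i hi
      rcases Nat.lt_or_ge i 38 with h | h
      · rw [g1 i h]; have := hfb i h; unfold sh; split_ifs <;> omega
      · rw [show i = 38 by omega, g2]; omega)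
    (by
      intro i j hi hj h
      rcases Nat.lt_or_ge i 38 with h1 | h1 <;> rcases Nat.lt_or_ge j 38 with h2 | h2
      · rw [g1 i h1, g1 j h2] at h
        apply hfi i j h1 h2
        have a1 := sh_lt x (f i) (f j)
        have a2 := sh_lt x (f j) (f i)
        omega
      · rw [g1 i h1, show j = 38 by omega, g2] at h
        exact absurd h.symm (sh_ne _ _)
      · rw [g1 j h2, show i = 38 by omega, g2] at h
        exact absurd h (sh_ne _ _)
      · omega)
  have hsq := hext π (by
    intro i j
    rw [hσf, Fin.lt_def, hπ, hπ, Fin.val_castSucc, Fin.val_castSucc, g1 _ i.2, g1 _ j.2, sh_lt])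
  obtain ⟨k, d, hd, hm, hs⟩ := exists_sq π hsq
  have hπg : ∀ i, i < 39 → seq π i = g i := fun i hi => by rw [seq_lt _ hi, hπ]
  have hb := hs.1
  have hk : k + 2 * d = 39 := by
    by_contra hne
    refine hnos ⟨k, d, hd, sq_congr hs (by omega) ?_⟩
    intro i j hi hj
    rw [hπg _ (by omega), hπg _ (by omega), g1 _ (by omega), g1 _ (by omega), sh_lt]
  obtain ⟨q, hq, rfl⟩ := exists_q hd hm (by omega)
  refine ⟨q, hq, ?_, ?_⟩
  · intro i j hi hij hj
    simp only [lo, if_true] at hi hj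
    have h := hs.2 (i - k) (j - k) (by omega) (by omega)
    rw [show k + (i - k) = i by omega, show k + (j - k) = j by omega,
      show k + dOf q + (i - k) = i + dOf q by omega,
      show k + dOf q + (j - k) = j + dOf q by omega,
      hπg _ (by omega), hπg _ (by omega), hπg _ (by omega), hπg _ (by omega),
      g1 _ (by omega), g1 _ (by omega), g1 _ (by omega), g1 _ (by omega), sh_lt, sh_lt] at h
    exact h
  · intro i hi hi2
    simp only [lo2, piv, par, if_true] at *
    have h := hs.2 (dOf q - 1) (i - dOf q - k) (by omega) (by omega)
    rw [show k + (dOf q - 1) = 38 - dOf q by omega, show k + (i - dOf q - k) = i - dOf q by omega,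
      show k + dOf q + (dOf q - 1) = 38 by omega,
      show k + dOf q + (i - dOf q - k) = i by omega,
      hπg _ (by omega), hπg _ (by omega), hπg _ (by omega), hπg _ (by omega),
      g1 _ (by omega), g1 _ (by omega), g2, g1 _ (by omega), sh_lt, lt_sh] at h
    exact h.symm

theorem left_cover (σ : Equiv.Perm (Fin 38)) (hσ : LeftCrucial σ) (x : ℕ) (hx : x ≤ 38) :
    ∃ q < 5, NS (seq σ) 1 q ∧ ∀ i, lo2 1 q ≤ i → i < lo2 1 q + (dOf q - 1) →
      (x ≤ seq σ i ↔ seq σ (piv 1 q) < seq σ (par 1 q i)) := by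
  have hnos : ¬ ∃ k d, 2 ≤ d ∧ Sq 38 (seq σ) k d := by
    rintro ⟨k, d, h⟩
    exact hσ.1 ⟨k, d, (hasSquareAt_iff _ _ _).2 h⟩
  have hfb : ∀ i < 38, seq σ i < 38 := fun i hi => by
    rw [seq_lt _ hi]; exact (σ ⟨i, hi⟩).2
  have hfi := seq_inj σ
  have hext : ∀ π : Equiv.Perm (Fin 39),
      (∀ i j : Fin 38, π i.succ < π j.succ ↔ σ i < σ j) → ContainsSquare π := hσ.2
  have hσf : ∀ i j : Fin 38, σ i < σ j ↔ seq σ i < seq σ j := by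
    intro i j
    rw [seq_lt _ i.2, seq_lt _ j.2]
    exact Fin.lt_def
  generalize seq σ = f at *
  let g : ℕ → ℕ := fun i => if i = 0 then x else sh x (f (i - 1))
  have g1 : ∀ i, g (i + 1) = sh x (f i) := fun i => by simp [g]
  have g2 : g 0 = x := if_pos rfl
  obtain ⟨π, hπ⟩ := exists_perm g
    (by
      intro i hi
      rcases i with _ | i
      · rw [g2]; omega
      · rw [g1 i]; have := hfb i (by omega); unfold sh; split_ifs <;> omega)
    (by
      intro i j hi hj h
      rcases i with _ | i <;> rcases j with _ | j
      · rfl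
      · rw [g1 j, g2] at h
        exact absurd h (sh_ne _ _)
      · rw [g1 i, g2] at h
        exact absurd h.symm (sh_ne _ _)
      · rw [g1 i, g1 j] at h
        rw [hfi i j (by omega) (by omega)]
        have a1 := sh_lt x (f i) (f j)
        have a2 := sh_lt x (f j) (f i)
        omega)
  have hsq := hext π (by
    intro i j
    rw [hσf, Fin.lt_def, hπ, hπ, Fin.val_succ, Fin.val_succ, g1, g1, sh_lt])
  obtain ⟨k, d, hd, hm, hs⟩ := exists_sq π hsq
  have hπg : ∀ i, i < 39 → seq π i = g i := fun i hi => by rw [seq_lt _ hi, hπ]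
  have hb := hs.1
  have hk : k = 0 := by
    by_contra hne
    refine hnos ⟨k - 1, d, hd, sq_congr hs (by omega) ?_⟩
    intro i j hi hj
    rw [hπg _ (by omega), hπg _ (by omega), show k + i = k - 1 + i + 1 by omega,
      show k + j = k - 1 + j + 1 by omega, g1, g1, sh_lt]
  subst hk
  obtain ⟨q, hq, rfl⟩ := exists_q hd hm (by omega)
  refine ⟨q, hq, ?_, ?_⟩
  · intro i j hi hij hj
    simp only [lo, one_ne_zero, if_false] at hi hj
    have h := hs.2 (i + 1) (j + 1) (by omega) (by omega)
    rw [show 0 + (i + 1) = i + 1 by omega, show 0 + (j + 1) = j + 1 by omega,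
      show 0 + dOf q + (i + 1) = i + dOf q + 1 by omega,
      show 0 + dOf q + (j + 1) = j + dOf q + 1 by omega,
      hπg _ (by omega), hπg _ (by omega), hπg _ (by omega), hπg _ (by omega),
      g1, g1, g1, g1, sh_lt, sh_lt] at h
    exact h
  · intro i hi hi2
    simp only [lo2, piv, par, one_ne_zero, if_false] at *
    have h := hs.2 0 (i + 1) (by omega) (by omega)
    rw [show 0 + 0 = 0 by omega, show 0 + (i + 1) = i + 1 by omega,
      show 0 + dOf q + 0 = dOf q - 1 + 1 by omega,
      show 0 + dOf q + (i + 1) = i + dOf q + 1 by omega,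
      hπg _ (by omega), hπg _ (by omega), hπg _ (by omega), hπg _ (by omega),
      g1, g2, g1, g1, sh_lt, lt_sh] at h
    exact h

theorem hyp_of_bicrucial (σ : Equiv.Perm (Fin 38)) (hσ : Bicrucial σ) : Hyp (seq σ) where
  inj := seq_inj σ
  nosq := by
    intro q k hq hk
    by_contra hcon
    push Not at hcon
    have hd := dOf_cases hq
    refine hσ.1.1 ⟨k, dOf q, (hasSquareAt_iff _ _ _).2 ⟨hd.1, hk, ?_⟩⟩
    intro i j hi hj
    have e1 : k + dOf q + i = k + i + dOf q := by omega
    have e2 : k + dOf q + j = k + j + dOf q := by omega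
    rw [e1, e2]
    rcases lt_trichotomy i j with h | rfl | h
    · exact hcon (k + i) (k + j) (by omega) (by omega) (by omega)
    · simp
    · have h1 := hcon (k + j) (k + i) (by omega) (by omega) (by omega)
      unfold Same at h1
      have n1 : seq σ (k + i) ≠ seq σ (k + j) := fun e => by
        have := seq_inj σ _ _ (by omega) (by omega) e; omega
      have n2 : seq σ (k + i + dOf q) ≠ seq σ (k + j + dOf q) := fun e => by
        have := seq_inj σ _ _ (by omega) (by omega) e; omega
      omega
  cover := by
    intro s dr e hs hdr he
    have hx : seq σ e + dr ≤ 38 := by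
      rw [seq_lt _ he]
      have := (σ ⟨e, he⟩).2
      omega
    interval_cases s
    · exact right_cover σ hσ.2 _ hx
    · exact left_cover σ hσ.1 _ hx

end NB38

/-- There is no bicrucial permutation of length 38. -/
theorem no_bicrucial_38 : ¬ ∃ σ : Equiv.Perm (Fin 38), Bicrucial σ := by
  
  rintro ⟨σ, hσ⟩
  exact NB38.no_hyp _ (NB38.hyp_of_bicrucial σ hσ)
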